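/- For any positive integer t, the multidimensional theta sum ∑ over vectors n = (n_0,...,n_{t-1}) ∈ ℤ^t with n_0 + ... + n_{t-1} = 0 of q^{(t/2)(n_0²+...+n_{t-1}²) + (0·n_0 + 1·n_1 + ... + (t-1)·n_{t-1})} equals E(q^t)^t / E(q), where E(q) = ∏_{n≥1}(1-q^n). -/

import Mathlib

/-- `E(q) = ∏_{n ≥ 1} (1 - qⁿ)`. -/
noncomputable def Eprod (q : ℂ) : ℂ := ∏' n : ℕ, (1 - q ^ (n + 1))

section KlyachkoIdentity

open Finset Filter Topology LaurentPolynomial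

/-- The Gaussian binomial coefficient `[n, m]_q`, defined by `q`-Pascal recursion. -/
def gaussBinom {K : Type*} [CommSemiring K] (q : K) : ℕ → ℕ → K
  | _, 0 => 1
  | 0, _ + 1 => 0
  | n + 1, m + 1 => gaussBinom q n m + q ^ (m + 1) * gaussBinom q n (m + 1)

/-- The finite `q`-Pochhammer product `∏_{j < n} (1 - q^{j+1})`. -/
def qPoch {K : Type*} [CommRing K] (q : K) (n : ℕ) : K := ∏ j ∈ range n, (1 - q ^ (j + 1))

/-- `k (k - 1) / 2`. -/
def triangular (k : ℤ) : ℤ := k * (k - 1) / 2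

lemma two_mul_triangular (k : ℤ) : 2 * triangular k = k * (k - 1) :=
  Int.mul_ediv_cancel' (Int.even_mul_pred_self k).two_dvd

lemma triangular_add_one (k : ℤ) : triangular (k + 1) = triangular k + k := by
  have h₁ := two_mul_triangular k
  have h₂ := two_mul_triangular (k + 1)
  linarith

lemma triangular_natCast (m : ℕ) : triangular m = m.choose 2 := by
  induction m with
  | zero => rfl
  | succ m ih =>
    rw [Nat.cast_succ, triangular_add_one, ih, Nat.choose_succ_succ' m 1]
    simp [add_comm]

section Finite

variable {K : Type*}

@[simp]
lemma gaussBinom_zero_right [CommSemiring K] (q : K) (n : ℕ) : gaussBinom q n 0 = 1 := by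
  cases n <;> rfl

lemma gaussBinom_succ_succ [CommSemiring K] (q : K) (n m : ℕ) :
    gaussBinom q (n + 1) (m + 1) = gaussBinom q n m + q ^ (m + 1) * gaussBinom q n (m + 1) := rfl

lemma gaussBinom_eq_zero_of_lt [CommSemiring K] (q : K) {n m : ℕ} (h : n < m) :
    gaussBinom q n m = 0 := by
  induction n generalizing m with
  | zero => obtain ⟨m, rfl⟩ := Nat.exists_eq_add_of_lt h; simp [gaussBinom]
  | succ n ih =>
    obtain ⟨m, rfl⟩ := Nat.exists_eq_add_of_lt (Nat.zero_lt_of_lt h)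
    rw [zero_add, gaussBinom_succ_succ, ih (by omega), ih (by omega)]
    simp

lemma qPoch_succ [CommRing K] (q : K) (n : ℕ) :
    qPoch q (n + 1) = qPoch q n * (1 - q ^ (n + 1)) := prod_range_succ _ _

lemma gaussBinom_mul_qPoch [CommRing K] (q : K) (m k : ℕ) :
    gaussBinom q (m + k) m * (qPoch q m * qPoch q k) = qPoch q (m + k) := by
  induction m generalizing k with
  | zero => simp [qPoch]
  | succ m ihm =>
    induction k with
    | zero =>
      have h := ihm 0
      rw [add_zero] at h ⊢
      rw [gaussBinom_succ_succ, gaussBinom_eq_zero_of_lt q m.lt_succ_self, qPoch_succ]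
      linear_combination (1 - q ^ (m + 1)) * h
    | succ k ihk =>
      have h := ihm (k + 1)
      rw [show m + 1 + k = m + k + 1 by ring] at ihk
      rw [show m + (k + 1) = m + k + 1 by ring] at h
      rw [show m + 1 + (k + 1) = m + k + 1 + 1 by ring, gaussBinom_succ_succ, qPoch_succ q m,
        qPoch_succ q (m + k + 1), qPoch_succ q k]
      rw [qPoch_succ q m] at ihk
      rw [qPoch_succ q k] at h
      linear_combination (1 - q ^ (m + 1)) * h + q ^ (m + 1) * (1 - q ^ (k + 1)) * ihk

/-- The `q`-binomial theorem. -/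
lemma prod_one_add_eq_sum_gaussBinom [CommRing K] (q c : K) (n : ℕ) :
    ∏ j ∈ range n, (1 + C (c * q ^ j) * T 1 : K[T;T⁻¹]) =
      ∑ m ∈ range (n + 1), C (gaussBinom q n m * q ^ m.choose 2 * c ^ m) * T (m : ℤ) := by
  induction n generalizing c with
  | zero => simp
  | succ n ih =>
    have h : ∏ j ∈ range n, (1 + C (c * q ^ (j + 1)) * T 1 : K[T;T⁻¹]) =
        ∏ j ∈ range n, (1 + C (c * q * q ^ j) * T 1) :=
      prod_congr rfl fun j _ => by rw [pow_succ', mul_assoc]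
    rw [prod_range_succ', h, ih, mul_add, pow_zero, mul_one, mul_one, sum_range_succ' _ (n + 1)]
    nth_rewrite 1 [← sum_range_succ_sub_top (n := n + 1)
      fun m => C (gaussBinom q n m * q ^ m.choose 2 * (c * q) ^ m) * (T (m : ℤ) : K[T;T⁻¹])]
    rw [sum_range_succ' _ (n + 1), gaussBinom_eq_zero_of_lt q n.lt_succ_self, sum_mul]
    simp only [zero_mul, map_zero, sub_zero]
    rw [add_right_comm, ← sum_add_distrib]
    congr 1
    · refine sum_congr rfl fun m _ => ?_
      rw [gaussBinom_succ_succ, Nat.choose_succ_succ' m 1, Nat.choose_one_right, Nat.cast_succ,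
        T_add]
      simp only [map_mul, map_add, map_pow]
      ring
    · simp

/-- The finite Jacobi triple product. -/
lemma prod_mul_prod_eq_sum_gaussBinom [Field K] {q c : K} (hq : q ≠ 0) (hc : c ≠ 0) (N M : ℕ) :
    (∏ j ∈ range N, (1 + C (c * q ^ j) * T 1 : K[T;T⁻¹])) *
      ∏ j ∈ range M, (1 + C (c⁻¹ * q ^ (j + 1)) * T (-1)) =
      ∑ m ∈ range (N + M + 1),
        C (gaussBinom q (N + M) m * q ^ triangular (m - M) * c ^ (m - M : ℤ)) * T (m - M : ℤ) := by
  induction M generalizing N c with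
  | zero =>
    rw [prod_range_zero, mul_one, prod_one_add_eq_sum_gaussBinom]
    refine sum_congr rfl fun m _ => ?_
    simp [triangular_natCast]
  | succ M ih =>
    have hT : (T (-1) * T 1 : K[T;T⁻¹]) = 1 := by rw [← T_add]; simp
    have hC : (C (c * q⁻¹) * C (c⁻¹ * q) : K[T;T⁻¹]) = 1 := by
      rw [← map_mul, ← map_one C]; congr 1; field_simp
    have hs := ih (c := c * q⁻¹) (by simp [hq, hc]) (N + 1)
    have h₁ : ∏ j ∈ range N, (1 + C (c * q⁻¹ * q ^ (j + 1)) * T 1 : K[T;T⁻¹]) =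
        ∏ j ∈ range N, (1 + C (c * q ^ j) * T 1) :=
      prod_congr rfl fun j _ => by rw [pow_succ']; congr 3; field_simp
    have h₂ : ∏ j ∈ range M, (1 + C ((c * q⁻¹)⁻¹ * q ^ (j + 1)) * T (-1) : K[T;T⁻¹]) =
        ∏ j ∈ range M, (1 + C (c⁻¹ * q ^ (j + 1 + 1)) * T (-1)) :=
      prod_congr rfl fun j _ => by rw [pow_succ' q (j + 1)]; congr 3; field_simp
    rw [prod_range_succ', h₁, h₂] at hs
    have h₃ : (1 + C (c⁻¹ * q ^ (0 + 1)) * T (-1) : K[T;T⁻¹]) =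
        C (c⁻¹ * q) * T (-1) * (1 + C (c * q⁻¹ * q ^ 0) * T 1) := by
      rw [pow_zero, mul_one, zero_add, pow_one]
      linear_combination (-1 : K[T;T⁻¹]) * hT - hC * (T (-1) * T 1)
    rw [prod_range_succ', h₃]
    trans C (c⁻¹ * q) * T (-1) * (∑ m ∈ range (N + 1 + M + 1),
        C (gaussBinom q (N + 1 + M) m * q ^ triangular (m - M) * (c * q⁻¹) ^ (m - M : ℤ)) *
          T (m - M : ℤ))
    · rw [← hs]
      ring
    · rw [mul_sum, show N + (M + 1) = N + 1 + M by ring]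
      refine sum_congr rfl fun m _ => ?_
      have h₄ := triangular_add_one (m - (M + 1 : ℕ))
      rw [show (m - (M + 1 : ℕ) + 1 : ℤ) = m - M by push_cast; ring] at h₄
      rw [show (C (c⁻¹ * q) * T (-1) * (C (gaussBinom q (N + 1 + M) m * q ^ triangular (m - M) *
        (c * q⁻¹) ^ (m - M : ℤ)) * T (m - M : ℤ)) : K[T;T⁻¹]) =
        (C (c⁻¹ * q) * C (gaussBinom q (N + 1 + M) m * q ^ triangular (m - M) *
        (c * q⁻¹) ^ (m - M : ℤ))) * (T (-1) * T (m - M : ℤ)) by ring, ← map_mul, ← T_add, h₄]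
      congr 2
      · rw [show (m - M : ℤ) = m - (M + 1 : ℕ) + 1 by push_cast; ring,
          zpow_add₀ hq, mul_zpow, zpow_add₀ hc, zpow_add₀ (inv_ne_zero hq), inv_zpow]
        field_simp
      · push_cast; ring

lemma prod_range_mul_eq_prod_fin {M : Type*} [CommMonoid M] (f : ℕ → M) (t N : ℕ) :
    ∏ n ∈ range (t * N), f n = ∏ i : Fin t, ∏ m ∈ range N, f (i + t * m) := by
  induction N with
  | zero => simp
  | succ N ih =>
    rw [mul_add_one, prod_range_add, ih]
    simp_rw [prod_range_succ, prod_mul_distrib]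
    rw [Finset.prod_range (fun x => f (t * N + x))]
    simp_rw [add_comm]

lemma prod_range_mul_eq_prod_fin_rev {M : Type*} [CommMonoid M] (f : ℕ → M) (t N : ℕ) :
    ∏ n ∈ range (t * N), f n = ∏ i : Fin t, ∏ m ∈ range N, f (t - (i + 1) + t * m) := by
  rw [prod_range_mul_eq_prod_fin, ← Equiv.prod_comp Fin.revPerm]
  simp

lemma prod_T [CommSemiring K] {ι : Type*} (s : Finset ι) (v : ι → ℤ) :
    ∏ i ∈ s, (T (v i) : K[T;T⁻¹]) = T (∑ i ∈ s, v i) := by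
  classical
  induction s using Finset.induction_on with
  | empty => simp
  | insert i s hi ih => rw [prod_insert hi, sum_insert hi, ih, T_add]

lemma coeff_C_mul_T_zero [CommSemiring K] (a : K) (n : ℤ) :
    (C a * T n : K[T;T⁻¹]).coeff 0 = if n = 0 then a else 0 := by
  rw [← single_eq_C_mul_T, AddMonoidAlgebra.coeff_single, Finsupp.single_apply]

/-- The symmetric finite Jacobi triple product. -/
lemma prod_mul_prod_eq_sum_Icc [Field K] {q c : K} (hq : q ≠ 0) (hc : c ≠ 0) (N : ℕ) :
    (∏ j ∈ range N, (1 + C (c * q ^ j) * T 1 : K[T;T⁻¹])) *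
      ∏ j ∈ range N, (1 + C (c⁻¹ * q ^ (j + 1)) * T (-1)) =
      ∑ k ∈ Icc (-N : ℤ) N,
        C (gaussBinom q (N + N) (k + N).toNat * q ^ triangular k * c ^ k) * T k := by
  rw [prod_mul_prod_eq_sum_gaussBinom hq hc]
  refine sum_nbij' (fun m => (m - N : ℤ)) (fun k => (k + N).toNat) ?_ ?_ ?_ ?_ ?_
  · intro m hm; simp at hm ⊢; omega
  · intro m hm; simp at hm ⊢; omega
  · intro m hm; simp
  · intro m hm; simp at hm ⊢; omega
  · intro m hm; simp

lemma gaussBinom_eq_sum_piFinset [Field K] {q : K} (hq : q ≠ 0) (t N : ℕ) :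
    gaussBinom q (t * N + t * N) (t * N) =
      ∑ v ∈ Fintype.piFinset (fun _ : Fin t => Icc (-N : ℤ) N),
        if ∑ i, v i = 0 then ∏ i, (gaussBinom (q ^ t) (N + N) (v i + N).toNat *
          (q ^ t) ^ triangular (v i) * (q ^ (i : ℕ)) ^ v i) else 0 := by
  have key := prod_mul_prod_eq_sum_Icc hq one_ne_zero (t * N)
  rw [prod_range_mul_eq_prod_fin, prod_range_mul_eq_prod_fin_rev, ← prod_mul_distrib] at key
  have h (i : Fin t) : (∏ m ∈ range N, (1 + C (1 * q ^ (i + t * m)) * T 1 : K[T;T⁻¹])) *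
      ∏ m ∈ range N, (1 + C (1⁻¹ * q ^ (t - (i + 1) + t * m + 1)) * T (-1)) =
      ∑ k ∈ Icc (-N : ℤ) N, C (gaussBinom (q ^ t) (N + N) (k + N).toNat *
        (q ^ t) ^ triangular k * (q ^ (i : ℕ)) ^ k) * T k := by
    rw [← prod_mul_prod_eq_sum_Icc (pow_ne_zero t hq) (pow_ne_zero i hq)]
    congr 1
    · refine prod_congr rfl fun m _ => ?_
      rw [one_mul, pow_add, pow_mul]
    · refine prod_congr rfl fun m _ => ?_
      congr 3
      rw [inv_one, one_mul, eq_inv_mul_iff_mul_eq₀ (pow_ne_zero _ hq), ← pow_mul, ← pow_add]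
      congr 1
      have := i.2
      rw [mul_add_one]
      omega
  rw [prod_congr rfl fun i _ => h i, prod_univ_sum] at key
  have hcoeff := congrArg (fun p : K[T;T⁻¹] => p.coeff 0) key
  simp_rw [prod_mul_distrib (g := fun i => T _), prod_T, ← map_prod,
    AddMonoidAlgebra.coeff_sum, Finsupp.finsetSum_apply, coeff_C_mul_T_zero] at hcoeff
  rw [hcoeff, sum_ite_eq' _ (0 : ℤ), if_pos (by rw [mem_Icc]; omega),
    zero_add, Int.toNat_natCast]
  simp [triangular]

end Finite

section Analysis

variable {q : ℂ}

lemma summable_norm_pow_succ (hq : ‖q‖ < 1) : Summable fun n : ℕ => ‖-q ^ (n + 1)‖ := by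
  simp_rw [norm_neg, norm_pow]
  exact (summable_nat_add_iff 1).2 (summable_geometric_of_lt_one (norm_nonneg q) hq)

lemma one_sub_pow_succ_ne_zero (hq : ‖q‖ < 1) (n : ℕ) : 1 + -q ^ (n + 1) ≠ 0 := by
  intro h
  have h₁ : q ^ (n + 1) = 1 := by linear_combination -h
  have h₂ : ‖q‖ ^ (n + 1) < 1 := pow_lt_one₀ (norm_nonneg q) hq n.succ_ne_zero
  rw [← norm_pow, h₁, norm_one] at h₂
  exact lt_irrefl _ h₂

lemma Eprod_ne_zero (hq : ‖q‖ < 1) : Eprod q ≠ 0 := by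
  simp_rw [Eprod, sub_eq_add_neg]
  exact tprod_one_add_ne_zero_of_summable (one_sub_pow_succ_ne_zero hq) (summable_norm_pow_succ hq)

lemma qPoch_ne_zero (hq : ‖q‖ < 1) (n : ℕ) : qPoch q n ≠ 0 :=
  prod_ne_zero_iff.2 fun j _ => by
    simpa only [sub_eq_add_neg] using one_sub_pow_succ_ne_zero hq j

lemma tendsto_qPoch (hq : ‖q‖ < 1) : Tendsto (qPoch q) atTop (𝓝 (Eprod q)) := by
  have h := (multipliable_one_add_of_summable (summable_norm_pow_succ hq)).hasProd.tendsto_prod_nat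
  simp_rw [← sub_eq_add_neg] at h
  exact h

lemma gaussBinom_eq_div (hq : ‖q‖ < 1) (m k : ℕ) :
    gaussBinom q (m + k) m = qPoch q (m + k) * (qPoch q m)⁻¹ * (qPoch q k)⁻¹ := by
  have hm := qPoch_ne_zero hq m
  have hk := qPoch_ne_zero hq k
  field_simp
  rw [← gaussBinom_mul_qPoch]
  ring

lemma exists_norm_gaussBinom_le (hq : ‖q‖ < 1) : ∃ B : ℝ, ∀ n m, ‖gaussBinom q n m‖ ≤ B := by
  obtain ⟨A, hA⟩ := isBounded_iff_forall_norm_le.1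
    (Metric.isBounded_range_of_tendsto _ (tendsto_qPoch hq))
  obtain ⟨A', hA'⟩ := isBounded_iff_forall_norm_le.1
    (Metric.isBounded_range_of_tendsto _ ((tendsto_qPoch hq).inv₀ (Eprod_ne_zero hq)))
  replace hA n := hA _ (Set.mem_range_self n)
  replace hA' n := hA' _ (Set.mem_range_self n)
  have hA0 := (norm_nonneg _).trans (hA 0)
  have hA0' := (norm_nonneg _).trans (hA' 0)
  refine ⟨A * A' * A', fun n m => ?_⟩
  rcases lt_or_ge n m with h | h
  · rw [gaussBinom_eq_zero_of_lt q h, norm_zero]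
    positivity
  · obtain ⟨k, rfl⟩ := Nat.exists_eq_add_of_le h
    rw [gaussBinom_eq_div hq, norm_mul, norm_mul]
    gcongr
    exacts [hA _, hA' _, hA' _]

lemma tendsto_gaussBinom (hq : ‖q‖ < 1) (k : ℤ) :
    Tendsto (fun N : ℕ => gaussBinom q (N + N) (k + N).toNat) atTop (𝓝 (Eprod q)⁻¹) := by
  have h := tendsto_qPoch hq
  have hE := Eprod_ne_zero hq
  have h₁ : Tendsto (fun N : ℕ => N + N) atTop atTop :=
    tendsto_atTop_mono (fun n => Nat.le_add_left n n) tendsto_id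
  have h₂ (k : ℤ) : Tendsto (fun N : ℕ => (k + N).toNat) atTop atTop :=
    tendsto_atTop_atTop.2 fun b => ⟨b + k.natAbs, fun N hN => by omega⟩
  have h₃ := ((h.comp h₁).mul ((h.comp (h₂ k)).inv₀ hE)).mul ((h.comp (h₂ (-k))).inv₀ hE)
  rw [mul_inv_cancel₀ hE, one_mul] at h₃
  refine h₃.congr' ?_
  filter_upwards [eventually_ge_atTop k.natAbs] with N hN
  have h₄ := gaussBinom_eq_div hq (k + N).toNat (-k + N).toNat
  rw [show (k + N).toNat + (-k + N).toNat = N + N by omega] at h₄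
  exact h₄.symm

lemma zpow_sum₀ {G ι : Type*} [CommGroupWithZero G] {a : G} (ha : a ≠ 0) (s : Finset ι)
    (v : ι → ℤ) : a ^ (∑ i ∈ s, v i) = ∏ i ∈ s, a ^ v i := by
  classical
  induction s using Finset.induction_on with
  | empty => simp
  | insert i s hi ih => rw [prod_insert hi, sum_insert hi, zpow_add₀ ha, ih]

lemma summable_prod_pi {ι : Type*} {f : ι → ℝ} (hf : Summable f) (h0 : 0 ≤ f) (t : ℕ) :
    Summable fun v : Fin t → ι => ∏ i, f (v i) := by
  induction t with
  | zero => exact (hasSum_fintype _).summable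
  | succ t ih =>
    rw [← (Fin.consEquiv fun _ => ι).summable_iff]
    have h := hf.mul_of_nonneg ih h0 fun v => prod_nonneg fun i _ => h0 _
    simpa [Function.comp_def, Fin.prod_univ_succ, Fin.consEquiv] using h

/-- The exponent in Klyachko's identity. -/
def coreExponent {t : ℕ} (v : Fin t → ℤ) : ℤ := ∑ i, (t * triangular (v i) + i * v i)

lemma coreExponent_eq {t : ℕ} {v : Fin t → ℤ} (hv : ∑ i, v i = 0) :
    coreExponent v = ((t : ℤ) * ∑ i, (v i) ^ 2) / 2 + ∑ i, (i.1 : ℤ) * v i := by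
  have h : ∑ i, (v i) ^ 2 = 2 * ∑ i, triangular (v i) := by
    rw [mul_sum, ← add_zero (∑ i, 2 * _), ← hv, ← sum_add_distrib]
    refine sum_congr rfl fun i _ => ?_
    rw [two_mul_triangular]
    ring
  rw [h, mul_left_comm, Int.mul_ediv_cancel_left _ two_ne_zero, mul_sum, ← sum_add_distrib]
  rfl

lemma sum_abs_le_two_mul_coreExponent {t : ℕ} {v : Fin t → ℤ} (hv : ∑ i, v i = 0) :
    ∑ i, |v i| ≤ 2 * coreExponent v := by
  have h : 2 * coreExponent v = ∑ i, (t * (v i) ^ 2 + (2 * i - (t - 1)) * v i) := by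
    rw [← add_zero (2 * _), ← hv, coreExponent, mul_sum, ← sum_add_distrib]
    refine sum_congr rfl fun i _ => ?_
    linear_combination (t : ℤ) * two_mul_triangular (v i)
  rw [h]
  refine sum_le_sum fun i _ => ?_
  have hi : (i : ℤ) + 1 ≤ t := by exact_mod_cast i.2
  have hi0 : (0 : ℤ) ≤ i := by positivity
  rcases lt_trichotomy (v i) 0 with h | h | h
  · rw [abs_of_neg h]
    nlinarith [mul_nonneg (neg_nonneg.2 h.le)
      (show (0 : ℤ) ≤ t * (-v i) - (2 * i - (t - 1)) - 1 by nlinarith)]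
  · simp [h]
  · rw [abs_of_pos h]
    nlinarith [mul_nonneg h.le
      (show (0 : ℤ) ≤ t * v i + (2 * i - (t - 1)) - 1 by nlinarith)]

lemma summable_norm_pow_coreExponent (h0 : q ≠ 0) (hq : ‖q‖ < 1) (t : ℕ) :
    Summable fun v : Fin t → ℤ => if ∑ i, v i = 0 then ‖q ^ coreExponent v‖ else 0 := by
  set r := √‖q‖
  have hr0 : 0 < r := Real.sqrt_pos.2 (norm_pos_iff.2 h0)
  have hr1 : r < 1 := by simpa using Real.sqrt_lt_sqrt (norm_nonneg q) hq
  have hr : ‖q‖ = r ^ (2 : ℤ) := (Real.sq_sqrt (norm_nonneg q)).symm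
  have hs : Summable fun k : ℤ => r ^ |k| := by
    refine Summable.of_nat_of_neg ?_ ?_ <;>
    simpa using summable_geometric_of_lt_one hr0.le hr1
  refine (summable_prod_pi hs (fun k => by positivity) t).of_nonneg_of_le ?_ ?_
  · intro v
    positivity
  · intro v
    split_ifs with hv
    · rw [norm_zpow, hr, ← zpow_mul]
      calc r ^ (2 * coreExponent v) ≤ r ^ (∑ i, |v i|) :=
            zpow_le_zpow_right_of_le_one₀ hr0 hr1.le (sum_abs_le_two_mul_coreExponent hv)
        _ = _ := zpow_sum₀ hr0.ne' _ _
    · positivity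

lemma tsum_coreExponent (h0 : q ≠ 0) (hq : ‖q‖ < 1) {t : ℕ} (ht : 0 < t) :
    ∑' v : Fin t → ℤ, (if ∑ i, v i = 0 then q ^ coreExponent v else 0) =
      Eprod (q ^ t) ^ t / Eprod q := by
  have hqt : ‖q ^ t‖ < 1 := by
    rw [norm_pow]
    exact pow_lt_one₀ (norm_nonneg q) hq ht.ne'
  obtain ⟨B, hB⟩ := exists_norm_gaussBinom_le hqt
  let F (N : ℕ) (v : Fin t → ℤ) : ℂ :=
    if v ∈ Fintype.piFinset (fun _ : Fin t => Icc (-N : ℤ) N) then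
      if ∑ i, v i = 0 then
        (∏ i, gaussBinom (q ^ t) (N + N) (v i + N).toNat) * q ^ coreExponent v else 0
    else 0
  have hF (N : ℕ) : ∑' v, F N v = gaussBinom q (t * N + t * N) (t * N) := by
    rw [gaussBinom_eq_sum_piFinset h0,
      tsum_eq_sum (s := Fintype.piFinset (fun _ : Fin t => Icc (-N : ℤ) N)) fun v hv => if_neg hv]
    refine sum_congr rfl fun v hv => ?_
    rw [if_pos hv]
    simp_rw [coreExponent, zpow_sum₀ h0, ← prod_mul_distrib, mul_assoc, ← zpow_natCast q,
      ← zpow_mul, ← zpow_add₀ h0]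
  have hlim : Tendsto (fun N => ∑' v, F N v) atTop
      (𝓝 (∑' v : Fin t → ℤ, if ∑ i, v i = 0 then
        (Eprod (q ^ t))⁻¹ ^ t * q ^ coreExponent v else 0)) := by
    refine tendsto_tsum_of_dominated_convergence
      ((summable_norm_pow_coreExponent h0 hq t).mul_left (B ^ t)) ?_ ?_
    · intro v
      have hmem : ∀ᶠ N : ℕ in atTop, v ∈ Fintype.piFinset (fun _ : Fin t => Icc (-N : ℤ) N) := by
        simp_rw [Fintype.mem_piFinset, eventually_all, mem_Icc]
        intro i
        filter_upwards [eventually_ge_atTop (v i).natAbs] with N hN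
        omega
      split_ifs with hv
      · have h := tendsto_finsetProd univ fun i _ => tendsto_gaussBinom hqt (v i)
        rw [prod_const, card_univ, Fintype.card_fin] at h
        refine (h.mul_const (q ^ coreExponent v)).congr' ?_
        filter_upwards [hmem] with N hN
        simp only [F, if_pos hN, if_pos hv]
      · simp [F, hv]
    · refine Eventually.of_forall fun N v => ?_
      have hB0 : 0 ≤ B := (norm_nonneg _).trans (hB 0 0)
      simp only [F]
      split_ifs with hN hv hv
      · rw [norm_mul, norm_prod]
        gcongr
        exact (prod_le_prod (fun i _ => norm_nonneg _) fun i _ => hB _ _).trans_eq (by simp)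
      · simp
      · rw [norm_zero]
        positivity
      · simp
  have hlim' : Tendsto (fun N => ∑' v, F N v) atTop (𝓝 (Eprod q)⁻¹) := by
    simp_rw [hF]
    have h := (tendsto_gaussBinom hq 0).comp (tendsto_id.const_mul_atTop' ht)
    simpa [Function.comp_def] using h
  have h := tendsto_nhds_unique hlim hlim'
  have hE := Eprod_ne_zero hqt
  simp_rw [← mul_ite_zero, tsum_mul_left] at h
  rw [inv_pow, inv_mul_eq_iff_eq_mul₀ (pow_ne_zero t hE)] at h
  rw [h, div_eq_mul_inv]

@[simp]
lemma Eprod_zero : Eprod 0 = 1 := by simp [Eprod]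

end Analysis

end KlyachkoIdentity

/-- Klyachko's identity: for a positive integer `t` and `|q| < 1`,
`∑_{n ∈ ℤᵗ, n·1 = 0} q^{(t/2) n·n + b_t·n} = E(q^t)^t / E(q)`,
where `b_t = (0,1,…,t-1)`.  (The exponent `(t/2) n·n + b_t·n` is a
nonnegative integer on the hyperplane `n·1 = 0`; it is written below using
exact integer division, since `n·n` is even there.) -/
theorem klyachko_tcore_identity (t : ℕ) (ht : 0 < t) (q : ℂ) (hq : ‖q‖ < 1) :
    ∑' v : {v : Fin t → ℤ // ∑ i, v i = 0},
        q ^ (((t : ℤ) * ∑ i, (v.1 i) ^ 2) / 2 + ∑ i, (i.1 : ℤ) * v.1 i) =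
      Eprod (q ^ t) ^ t / Eprod q := by
  rw [tsum_congr fun v => by rw [← coreExponent_eq v.2]]
  rcases eq_or_ne q 0 with rfl | h0
  · rw [zero_pow ht.ne', Eprod_zero, one_pow, div_one,
      tsum_eq_single ⟨0, by simp⟩ fun v hv => ?_]
    · simp [coreExponent, triangular]
    · refine zero_zpow _ fun h => hv ?_
      have h' := sum_abs_le_two_mul_coreExponent v.2
      rw [h, mul_zero] at h'
      ext i
      exact abs_nonpos_iff.1
        ((Finset.single_le_sum (fun j _ => abs_nonneg (v.1 j)) (Finset.mem_univ i)).trans h')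
  · rw [← tsum_coreExponent h0 hq ht]
    exact (tsum_subtype {v : Fin t → ℤ | ∑ i, v i = 0} fun v => q ^ coreExponent v).trans
      (tsum_congr fun v => by simp [Set.indicator_apply])
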